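/- arXiv:1611.08423 — 6 statements merged into one kernel-verified Lean document; each statement's English description precedes it below -/
import Mathlib

section
/- For each fixed x, y > 0, the function σ ↦ B_σ(x, y) is log-convex on (0, ∞); that is, for all σ₁, σ₂ > 0 and α ∈ [0, 1], B_{α σ₁ + (1−α) σ₂}(x, y) ≤ (B_{σ₁}(x, y))^α · (B_{σ₂}(x, y))^{1−α}. -/
open Real intervalIntegral

/-- The extended beta function `B_σ(x, y) = ∫₀¹ t^(x-1) (1-t)^(y-1) exp(-σ/(t(1-t))) dt`. -/
noncomputable def extBeta (σ x y : ℝ) : ℝ :=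
  ∫ t in (0:ℝ)..1, t ^ (x - 1) * (1 - t) ^ (y - 1) * Real.exp (-σ / (t * (1 - t)))

open MeasureTheory in
/-- Hölder's inequality for the weighted geometric mean of two nonnegative integrable functions. -/
lemma integral_rpow_mul_rpow_one_sub_le {X : Type*} [MeasurableSpace X] {μ : Measure X}
    {f g : X → ℝ} (hf₀ : 0 ≤ᵐ[μ] f) (hg₀ : 0 ≤ᵐ[μ] g) (hf : Integrable f μ)
    (hg : Integrable g μ) {a : ℝ} (ha₀ : 0 < a) (ha₁ : a < 1) :
    ∫ t, f t ^ a * g t ^ (1 - a) ∂μ ≤ (∫ t, f t ∂μ) ^ a * (∫ t, g t ∂μ) ^ (1 - a) := by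
  have memLp_rpow {h : X → ℝ} (hh₀ : 0 ≤ᵐ[μ] h) (hh : Integrable h μ) {b : ℝ} (hb : 0 < b) :
      MemLp (fun t ↦ h t ^ b) (ENNReal.ofReal b⁻¹) μ := by
    have hb' : 0 < b⁻¹ := inv_pos.2 hb
    rw [← integrable_norm_rpow_iff (hh.1.aemeasurable.pow_const b).aestronglyMeasurable
      (by simpa using hb) ENNReal.ofReal_ne_top, ENNReal.toReal_ofReal hb'.le]
    refine hh.congr ?_
    filter_upwards [hh₀] with t ht
    rw [Real.norm_of_nonneg (Real.rpow_nonneg ht b), Real.rpow_rpow_inv ht hb.ne']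
  have integral_rpow {h : X → ℝ} (hh₀ : 0 ≤ᵐ[μ] h) {b : ℝ} (hb : 0 < b) :
      ∫ t, (h t ^ b) ^ b⁻¹ ∂μ = ∫ t, h t ∂μ := by
    refine integral_congr_ae ?_
    filter_upwards [hh₀] with t ht using Real.rpow_rpow_inv ht hb.ne'
  have hb : 0 < 1 - a := sub_pos.2 ha₁
  have key := integral_mul_le_Lp_mul_Lq_of_nonneg (Real.HolderConjugate.inv_one_sub_inv ha₀ ha₁)
    (hf₀.mono fun t ht ↦ Real.rpow_nonneg ht a) (hg₀.mono fun t ht ↦ Real.rpow_nonneg ht (1 - a))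
    (memLp_rpow hf₀ hf ha₀) (memLp_rpow hg₀ hg hb)
  rwa [integral_rpow hf₀ ha₀, integral_rpow hg₀ hb, one_div, one_div, inv_inv, inv_inv] at key

open MeasureTheory in
lemma integrableOn_rpow_mul_one_sub_rpow {x y : ℝ} (hx : 0 < x) (hy : 0 < y) :
    IntegrableOn (fun t : ℝ ↦ t ^ (x - 1) * (1 - t) ^ (y - 1)) (Set.Ioo 0 1) := by
  have h := Complex.betaIntegral_convergent (u := x) (v := y) (by simpa) (by simpa)
  rw [intervalIntegrable_iff_integrableOn_Ioo_of_le zero_le_one] at h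
  refine IntegrableOn.congr_fun h.norm (fun t ht ↦ ?_) measurableSet_Ioo
  have ht' : 0 < 1 - t := sub_pos.2 ht.2
  have e : (1 : ℂ) - t = ((1 - t : ℝ) : ℂ) := by push_cast; rfl
  simp only [norm_mul]
  rw [e, Complex.norm_cpow_eq_rpow_re_of_pos ht.1, Complex.norm_cpow_eq_rpow_re_of_pos ht']
  simp

open MeasureTheory in
lemma integrableOn_extBeta {x y σ : ℝ} (hx : 0 < x) (hy : 0 < y) (hσ : 0 ≤ σ) :
    IntegrableOn (fun t : ℝ ↦ t ^ (x - 1) * (1 - t) ^ (y - 1) * Real.exp (-σ / (t * (1 - t))))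
      (Set.Ioo 0 1) := by
  refine (integrableOn_rpow_mul_one_sub_rpow hx hy).mul_bdd (c := 1)
    (by fun_prop : Measurable _).aestronglyMeasurable ?_
  filter_upwards [ae_restrict_mem measurableSet_Ioo] with t ht
  rw [Real.norm_of_nonneg (Real.exp_pos _).le, Real.exp_le_one_iff]
  exact div_nonpos_of_nonpos_of_nonneg (neg_nonpos.2 hσ)
    (mul_pos ht.1 (sub_pos.2 ht.2)).le

open MeasureTheory in
lemma extBeta_eq_integral_Ioo (σ x y : ℝ) :
    extBeta σ x y =
      ∫ t in Set.Ioo (0:ℝ) 1,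
        t ^ (x - 1) * (1 - t) ^ (y - 1) * Real.exp (-σ / (t * (1 - t))) := by
  rw [extBeta, intervalIntegral.integral_of_le zero_le_one, integral_Ioc_eq_integral_Ioo]

lemma mul_exp_rpow_mul_rpow_one_sub {w : ℝ} (hw : 0 < w) (u v a : ℝ) :
    (w * Real.exp u) ^ a * (w * Real.exp v) ^ (1 - a) =
      w * Real.exp (a * u + (1 - a) * v) := by
  rw [Real.mul_rpow hw.le (Real.exp_pos u).le, Real.mul_rpow hw.le (Real.exp_pos v).le,
    ← Real.exp_mul, ← Real.exp_mul, mul_mul_mul_comm, ← Real.rpow_add hw, ← Real.exp_add,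
    add_sub_cancel, Real.rpow_one, mul_comm u, mul_comm v]

/-- For fixed x, y > 0, σ ↦ B_σ(x, y) is log-convex on (0, ∞). -/
theorem extBeta_logConvex_in_sigma (x y : ℝ) (hx : 0 < x) (hy : 0 < y) :
    ∀ σ₁ σ₂ α : ℝ, 0 < σ₁ → 0 < σ₂ → α ∈ Set.Icc (0:ℝ) 1 →
      extBeta (α * σ₁ + (1 - α) * σ₂) x y ≤
        extBeta σ₁ x y ^ α * extBeta σ₂ x y ^ (1 - α) := by
  rintro σ₁ σ₂ α h₁ h₂ ⟨hα₀, hα₁⟩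
  rcases hα₀.eq_or_lt with rfl | hα₀
  · simp
  rcases hα₁.eq_or_lt with rfl | hα₁
  · simp
  have nonneg (σ : ℝ) : 0 ≤ᵐ[MeasureTheory.volume.restrict (Set.Ioo (0:ℝ) 1)] fun t : ℝ ↦
      t ^ (x - 1) * (1 - t) ^ (y - 1) * Real.exp (-σ / (t * (1 - t))) := by
    filter_upwards [MeasureTheory.ae_restrict_mem measurableSet_Ioo] with t ht
    have ht₀ : 0 ≤ t := ht.1.le
    have ht₁ : 0 ≤ 1 - t := sub_nonneg.2 ht.2.le
    show 0 ≤ t ^ (x - 1) * (1 - t) ^ (y - 1) * Real.exp (-σ / (t * (1 - t)))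
    positivity
  simp only [extBeta_eq_integral_Ioo]
  refine le_of_eq_of_le ?_ (integral_rpow_mul_rpow_one_sub_le (nonneg σ₁) (nonneg σ₂)
    (integrableOn_extBeta hx hy h₁.le) (integrableOn_extBeta hx hy h₂.le) hα₀ hα₁)
  refine MeasureTheory.setIntegral_congr_fun measurableSet_Ioo fun t ht ↦ ?_
  have hw : 0 < t ^ (x - 1) * (1 - t) ^ (y - 1) :=
    mul_pos (Real.rpow_pos_of_pos ht.1 _) (Real.rpow_pos_of_pos (sub_pos.2 ht.2) _)
  simp only [mul_exp_rpow_mul_rpow_one_sub hw]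
  congr 2
  ring
end

section
/- Let x, y > 0, σ > 0 and a ∈ ℝ with σ − a ≥ 0 and σ + a ≥ 0. Then the extended beta function satisfies the Turán-type inequality B_σ(x, y)² − B_{σ+a}(x, y) · B_{σ−a}(x, y) ≤ 0. -/
open Real intervalIntegral

lemma intervalIntegrable_rpow_mul_one_sub_rpow {x y : ℝ} (hx : 0 < x) (hy : 0 < y) :
    IntervalIntegrable (fun t : ℝ ↦ t ^ (x - 1) * (1 - t) ^ (y - 1)) MeasureTheory.volume 0 1 := by
  have h := (Complex.betaIntegral_convergent (u := (x : ℂ)) (v := (y : ℂ))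
    (by simpa) (by simpa)).norm
  refine h.congr fun t ht ↦ ?_
  rw [Set.uIoc_of_le zero_le_one] at ht
  have h0 : 0 ≤ t := ht.1.le
  have h1 : 0 ≤ 1 - t := sub_nonneg.mpr ht.2
  have hc : ((t : ℂ) ^ ((x : ℂ) - 1) * (1 - (t : ℂ)) ^ ((y : ℂ) - 1)) =
      ((t ^ (x - 1) * (1 - t) ^ (y - 1) : ℝ) : ℂ) := by
    push_cast [Complex.ofReal_cpow h0, Complex.ofReal_cpow h1]
    rfl
  simp only [hc, Complex.norm_real, Real.norm_eq_abs]
  exact abs_of_nonneg (by positivity)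

lemma intervalIntegrable_extBeta {σ x y : ℝ} (hσ : 0 ≤ σ) (hx : 0 < x) (hy : 0 < y) :
    IntervalIntegrable
      (fun t : ℝ ↦ t ^ (x - 1) * (1 - t) ^ (y - 1) * Real.exp (-σ / (t * (1 - t))))
      MeasureTheory.volume 0 1 := by
  refine (intervalIntegrable_rpow_mul_one_sub_rpow hx hy).mono_fun
    (Measurable.aestronglyMeasurable (by fun_prop)) ?_
  refine MeasureTheory.ae_restrict_of_forall_mem measurableSet_uIoc fun t ht ↦ ?_
  rw [Set.uIoc_of_le zero_le_one] at ht
  have h : Real.exp (-σ / (t * (1 - t))) ≤ 1 := Real.exp_le_one_iff.mpr <|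
    div_nonpos_of_nonpos_of_nonneg (neg_nonpos.mpr hσ)
      (mul_nonneg ht.1.le (sub_nonneg.mpr ht.2))
  beta_reduce
  rw [norm_mul _ (Real.exp _), Real.norm_eq_abs (Real.exp _), Real.abs_exp]
  exact mul_le_of_le_one_right (norm_nonneg _) h

/-- Turán-type inequality for the extended beta function. -/
theorem extBeta_turan (x y σ a : ℝ) (hx : 0 < x) (hy : 0 < y) (hσ : 0 < σ)
    (ha₁ : 0 ≤ σ - a) (ha₂ : 0 ≤ σ + a) :
    extBeta σ x y ^ 2 - extBeta (σ + a) x y * extBeta (σ - a) x y ≤ 0 := by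
  have hquad (s : ℝ) : 0 ≤ extBeta (σ + a) x y * (s * s) + 2 * extBeta σ x y * s +
      extBeta (σ - a) x y := by
    have hp := (intervalIntegrable_extBeta ha₂ hx hy).mul_const (s * s)
    have hm := (intervalIntegrable_extBeta hσ.le hx hy).mul_const (2 * s)
    have hr := intervalIntegrable_extBeta ha₁ hx hy
    rw [show 2 * extBeta σ x y * s = extBeta σ x y * (2 * s) by ring]
    unfold extBeta
    rw [← integral_mul_const, ← integral_mul_const, ← integral_add hp hm,
      ← integral_add (hp.add hm) hr]
    refine integral_nonneg zero_le_one fun t ht ↦ ?_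
    have h0 : 0 ≤ t := ht.1
    have h1 : 0 ≤ 1 - t := sub_nonneg.mpr ht.2
    set p := Real.exp (-(σ + a) / (t * (1 - t)) / 2) with hpdef
    set r := Real.exp (-(σ - a) / (t * (1 - t)) / 2) with hrdef
    have ep : Real.exp (-(σ + a) / (t * (1 - t))) = p * p := by
      rw [hpdef, ← Real.exp_add]; ring_nf
    have er : Real.exp (-(σ - a) / (t * (1 - t))) = r * r := by
      rw [hrdef, ← Real.exp_add]; ring_nf
    have em : Real.exp (-σ / (t * (1 - t))) = p * r := by
      rw [hpdef, hrdef, ← Real.exp_add]; ring_nf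
    rw [ep, er, em]
    have hsq : 0 ≤ t ^ (x - 1) * (1 - t) ^ (y - 1) * (p * s + r) ^ 2 := by positivity
    linarith
  have hd := discrim_le_zero hquad
  unfold discrim at hd
  linarith
end

section
/- Let σ₁, σ₂, x, y > 0. Then | B_{σ₁+σ₂}(x+y+1, x+y+1) − B_{σ₁}(x+1, x+1) · B_{σ₂}(y+1, y+1) | ≤ exp(−4(σ₁+σ₂)) / 4^{x+y+1}. -/
open Real intervalIntegral

open MeasureTheory in
/-- Grüss inequality on a probability space, for functions with values in `[0, M]` and `[0, N]`. -/
theorem abs_integral_mul_sub_le_of_mem_Icc {Ω : Type*} [MeasurableSpace Ω] {μ : Measure Ω}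
    [IsProbabilityMeasure μ] {f g : Ω → ℝ} {M N : ℝ}
    (hf : AEStronglyMeasurable f μ) (hg : AEStronglyMeasurable g μ)
    (hfM : ∀ᵐ t ∂μ, f t ∈ Set.Icc 0 M) (hgN : ∀ᵐ t ∂μ, g t ∈ Set.Icc 0 N) :
    |(∫ t, f t * g t ∂μ) - (∫ t, f t ∂μ) * ∫ t, g t ∂μ| ≤ M * N / 4 := by
  have hfi : Integrable f μ := Integrable.of_mem_Icc 0 M hf.aemeasurable hfM
  have hgi : Integrable g μ := Integrable.of_mem_Icc 0 N hg.aemeasurable hgN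
  have hfg : Integrable (fun t => f t * g t) μ := by
    refine Integrable.of_mem_Icc 0 (M * N) (hf.mul hg).aemeasurable ?_
    filter_upwards [hfM, hgN] with t hft hgt
    exact ⟨mul_nonneg hft.1 hgt.1, mul_le_mul hft.2 hgt.2 hgt.1 (hft.1.trans hft.2)⟩
  have hf0 : 0 ≤ ∫ t, f t ∂μ := integral_nonneg_of_ae (hfM.mono fun t h => h.1)
  have hg0 : 0 ≤ ∫ t, g t ∂μ := integral_nonneg_of_ae (hgN.mono fun t h => h.1)
  have hfg0 : 0 ≤ ∫ t, f t * g t ∂μ := by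
    refine integral_nonneg_of_ae ?_
    filter_upwards [hfM, hgN] with t hft hgt using mul_nonneg hft.1 hgt.1
  have hf1 : ∫ t, f t ∂μ ≤ M := by
    simpa using integral_mono_ae hfi (integrable_const M) (hfM.mono fun t h => h.2)
  have hg1 : ∫ t, g t ∂μ ≤ N := by
    simpa using integral_mono_ae hgi (integrable_const N) (hgN.mono fun t h => h.2)
  have hM : ∫ t, f t * g t ∂μ ≤ M * ∫ t, g t ∂μ := by
    rw [← MeasureTheory.integral_const_mul]
    refine integral_mono_ae hfg (hgi.const_mul M) ?_
    filter_upwards [hfM, hgN] with t hft hgt using mul_le_mul_of_nonneg_right hft.2 hgt.1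
  have hN : ∫ t, f t * g t ∂μ ≤ (∫ t, f t ∂μ) * N := by
    rw [← MeasureTheory.integral_mul_const]
    refine integral_mono_ae hfg (hfi.mul_const N) ?_
    filter_upwards [hfM, hgN] with t hft hgt using mul_le_mul_of_nonneg_left hgt.2 hft.1
  have hsum : Integrable (fun t => f t * N + M * g t) μ :=
    (hfi.mul_const N).add (hgi.const_mul M)
  have hMN : (∫ t, f t ∂μ) * N + M * (∫ t, g t ∂μ) - M * N ≤ ∫ t, f t * g t ∂μ := by
    have h : ∫ t, (f t * N + M * g t - M * N) ∂μ =
        (∫ t, f t ∂μ) * N + M * (∫ t, g t ∂μ) - M * N := by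
      rw [MeasureTheory.integral_sub hsum (integrable_const _),
        MeasureTheory.integral_add (hfi.mul_const N) (hgi.const_mul M),
        MeasureTheory.integral_mul_const, MeasureTheory.integral_const_mul]
      simp
    rw [← h]
    refine integral_mono_ae (hsum.sub (integrable_const _)) hfg ?_
    filter_upwards [hfM, hgN] with t hft hgt
    nlinarith [mul_nonneg (sub_nonneg.2 hft.2) (sub_nonneg.2 hgt.2)]
  generalize (∫ t, f t * g t ∂μ) = c at *
  generalize (∫ t, f t ∂μ) = a at *
  generalize (∫ t, g t ∂μ) = b at *
  have hM0 : 0 ≤ M := hf0.trans hf1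
  have hN0 : 0 ≤ N := hg0.trans hg1
  rcases hM0.eq_or_lt with rfl | hMpos
  · have : a = 0 := le_antisymm hf1 hf0
    subst this
    have : c = 0 := by linarith
    simp [this]
  rcases hN0.eq_or_lt with rfl | hNpos
  · have : b = 0 := le_antisymm hg1 hg0
    subst this
    have : c = 0 := by linarith
    simp [this]
  obtain ⟨p, rfl⟩ : ∃ p, a = M * p := ⟨a / M, by field_simp⟩
  obtain ⟨q, rfl⟩ : ∃ q, b = N * q := ⟨b / N, by field_simp⟩
  obtain ⟨r, rfl⟩ : ∃ r, c = M * N * r := ⟨c / (M * N), by field_simp⟩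
  have hMNpos : 0 < M * N := mul_pos hMpos hNpos
  have hp0 : 0 ≤ p := nonneg_of_mul_nonneg_right hf0 hMpos
  have hq0 : 0 ≤ q := nonneg_of_mul_nonneg_right hg0 hNpos
  have hr0 : 0 ≤ r := nonneg_of_mul_nonneg_right hfg0 hMNpos
  have hp1 : p ≤ 1 := le_of_mul_le_mul_left (by linarith) hMpos
  have hq1 : q ≤ 1 := le_of_mul_le_mul_left (by linarith) hNpos
  have hrq : r ≤ q := le_of_mul_le_mul_left (by linarith) hMNpos
  have hrp : r ≤ p := le_of_mul_le_mul_left (by linarith) hMNpos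
  have hpq : p + q - 1 ≤ r := le_of_mul_le_mul_left (by linarith) hMNpos
  have key : |r - p * q| ≤ 1 / 4 := by
    refine abs_le.2 ⟨?_, ?_⟩
    · rcases le_total (p + q) 1 with h | h
      · nlinarith [sq_nonneg (p - q)]
      · nlinarith [sq_nonneg (p - q)]
    · rcases le_total p q with h | h
      · nlinarith [sq_nonneg (p - 1 / 2)]
      · nlinarith [sq_nonneg (q - 1 / 2)]
  calc |M * N * r - M * p * (N * q)| = M * N * |r - p * q| := by
        rw [← abs_of_pos hMNpos, ← abs_mul, abs_of_pos hMNpos]; ring_nf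
    _ ≤ M * N * (1 / 4) := by gcongr
    _ = M * N / 4 := by ring

/-- The symmetric extended beta integrand attains its maximum on `[0, 1]` at `t = 1/2`. -/
theorem extBeta_integrand_mem_Icc {σ x t : ℝ} (hσ : 0 ≤ σ) (hx : 0 < x)
    (ht : t ∈ Set.Icc (0 : ℝ) 1) :
    t ^ x * (1 - t) ^ x * Real.exp (-σ / (t * (1 - t))) ∈
      Set.Icc 0 (Real.exp (-(4 * σ)) / (4 : ℝ) ^ x) := by
  have ht1 : 0 ≤ 1 - t := sub_nonneg.2 ht.2
  rw [← Real.mul_rpow ht.1 ht1]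
  have hu0 : 0 ≤ t * (1 - t) := mul_nonneg ht.1 ht1
  have hu1 : t * (1 - t) ≤ 1 / 4 := by nlinarith [sq_nonneg (t - 1 / 2)]
  generalize t * (1 - t) = u at *
  refine ⟨by positivity, ?_⟩
  rcases hu0.eq_or_lt with rfl | hu
  · rw [Real.zero_rpow hx.ne', zero_mul]
    positivity
  have hexp : Real.exp (-σ / u) ≤ Real.exp (-(4 * σ)) := by
    rw [Real.exp_le_exp, div_le_iff₀ hu]
    nlinarith
  calc u ^ x * Real.exp (-σ / u) ≤ (1 / 4 : ℝ) ^ x * Real.exp (-(4 * σ)) := by gcongr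
    _ = Real.exp (-(4 * σ)) / (4 : ℝ) ^ x := by
        rw [Real.div_rpow zero_le_one (by norm_num), Real.one_rpow]; ring

/-- Grüss-type inequality for extended beta functions. -/
theorem extBeta_gruss (σ₁ σ₂ x y : ℝ) (hσ₁ : 0 < σ₁) (hσ₂ : 0 < σ₂)
    (hx : 0 < x) (hy : 0 < y) :
    |extBeta (σ₁ + σ₂) (x + y + 1) (x + y + 1) -
        extBeta σ₁ (x + 1) (x + 1) * extBeta σ₂ (y + 1) (y + 1)| ≤
      Real.exp (-(4 * (σ₁ + σ₂))) / (4:ℝ) ^ (x + y + 1) := by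
  let F : ℝ → ℝ → ℝ → ℝ := fun σ z t => t ^ z * (1 - t) ^ z * Real.exp (-σ / (t * (1 - t)))
  let μ : MeasureTheory.Measure ℝ := MeasureTheory.volume.restrict (Set.Ioc 0 1)
  have : MeasureTheory.IsProbabilityMeasure μ := ⟨by simp [μ]⟩
  have hB (σ z : ℝ) : extBeta σ (z + 1) (z + 1) = ∫ t, F σ z t ∂μ := by
    simp [extBeta, F, μ, integral_of_le]
  have hmeas (σ z : ℝ) : MeasureTheory.AEStronglyMeasurable (F σ z) μ :=
    Measurable.aestronglyMeasurable (by fun_prop)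
  have hmem : ∀ᵐ t ∂μ, t ∈ Set.Ioc (0 : ℝ) 1 :=
    MeasureTheory.ae_restrict_mem measurableSet_Ioc
  have hbound {σ z : ℝ} (hσ : 0 < σ) (hz : 0 < z) :
      ∀ᵐ t ∂μ, F σ z t ∈ Set.Icc 0 (Real.exp (-(4 * σ)) / (4 : ℝ) ^ z) :=
    hmem.mono fun t ht => extBeta_integrand_mem_Icc hσ.le hz ⟨ht.1.le, ht.2⟩
  have hmul : ∫ t, F (σ₁ + σ₂) (x + y) t ∂μ = ∫ t, F σ₁ x t * F σ₂ y t ∂μ := by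
    refine MeasureTheory.integral_congr_ae (hmem.mono fun t ht => ?_)
    simp only [F]
    rw [Real.rpow_add_of_nonneg ht.1.le hx.le hy.le,
      Real.rpow_add_of_nonneg (sub_nonneg.2 ht.2) hx.le hy.le, neg_add, add_div, Real.exp_add]
    ring
  have hconst : Real.exp (-(4 * (σ₁ + σ₂))) / (4 : ℝ) ^ (x + y + 1) =
      Real.exp (-(4 * σ₁)) / (4 : ℝ) ^ x * (Real.exp (-(4 * σ₂)) / (4 : ℝ) ^ y) / 4 := by
    rw [mul_add, neg_add, Real.exp_add, Real.rpow_add four_pos, Real.rpow_add four_pos,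
      Real.rpow_one]
    field_simp
  rw [hB, hB, hB, hmul, hconst]
  exact abs_integral_mul_sub_le_of_mem_Icc (hmeas _ _) (hmeas _ _)
    (hbound hσ₁ hx) (hbound hσ₂ hy)
end

section
/- Let σ₁, σ₂, x, y > 0. Then | B_{σ₁+σ₂}(x+y+1, x+y+1) − B_{σ₁}(x+1, x+1) · B_{σ₂}(y+1, y+1) | ≤ [ B_{2σ₁}(2x+1, 2x+1) − B_{σ₁}(x+1, x+1)² ]^{1/2} · [ B_{2σ₂}(2y+1, 2y+1) − B_{σ₂}(y+1, y+1)² ]^{1/2}. -/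
open Real intervalIntegral

open MeasureTheory ProbabilityTheory in
/-- The Cauchy-Schwarz inequality for covariances. -/
lemma abs_covariance_le_sqrt_variance_mul_sqrt_variance {Ω : Type*} [MeasurableSpace Ω]
    {μ : Measure Ω} [IsFiniteMeasure μ] {X Y : Ω → ℝ} (hX : MemLp X 2 μ) (hY : MemLp Y 2 μ) :
    |cov[X, Y; μ]| ≤ √(Var[X; μ]) * √(Var[Y; μ]) := by
  rw [← Real.sqrt_mul (variance_nonneg X μ)]
  refine Real.abs_le_sqrt ?_
  have h := discrim_le_zero (a := Var[Y; μ]) (b := 2 * cov[X, Y; μ]) (c := Var[X; μ]) fun c ↦ by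
    have h := variance_nonneg (X + c • Y) μ
    rw [variance_add hX (hY.const_smul c), variance_smul, covariance_smul_right] at h
    linarith
  rw [discrim] at h
  linarith

/-- The integrand of `extBeta σ (x + 1) (x + 1)`. -/
noncomputable def extBetaKernel (σ x t : ℝ) : ℝ :=
  t ^ x * (1 - t) ^ x * Real.exp (-σ / (t * (1 - t)))

lemma extBeta_add_one (σ x : ℝ) :
    extBeta σ (x + 1) (x + 1) = ∫ t in Set.Ioo (0 : ℝ) 1, extBetaKernel σ x t := by
  rw [extBeta, integral_of_le zero_le_one, MeasureTheory.integral_Ioc_eq_integral_Ioo]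
  simp only [extBetaKernel, add_sub_cancel_right]

lemma extBetaKernel_mul (σ₁ σ₂ x y : ℝ) {t : ℝ} (ht : t ∈ Set.Ioo (0 : ℝ) 1) :
    extBetaKernel σ₁ x t * extBetaKernel σ₂ y t = extBetaKernel (σ₁ + σ₂) (x + y) t := by
  simp only [extBetaKernel]
  rw [Real.rpow_add ht.1, Real.rpow_add (sub_pos.2 ht.2), neg_add, add_div, Real.exp_add]
  ring

lemma extBeta_add_add_add_one (σ₁ σ₂ x y : ℝ) :
    extBeta (σ₁ + σ₂) (x + y + 1) (x + y + 1) =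
      ∫ t in Set.Ioo (0 : ℝ) 1, extBetaKernel σ₁ x t * extBetaKernel σ₂ y t := by
  rw [extBeta_add_one]
  exact MeasureTheory.setIntegral_congr_fun measurableSet_Ioo fun t ht ↦
    (extBetaKernel_mul σ₁ σ₂ x y ht).symm

open MeasureTheory in
lemma memLp_extBetaKernel {σ x : ℝ} (hσ : 0 ≤ σ) (hx : 0 ≤ x) (p : ENNReal) :
    MemLp (extBetaKernel σ x) p (volume.restrict (Set.Ioo 0 1)) := by
  have hmeas : Measurable (extBetaKernel σ x) := by
    unfold extBetaKernel
    fun_prop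
  refine MemLp.of_bound hmeas.aestronglyMeasurable 1 ?_
  filter_upwards [ae_restrict_mem measurableSet_Ioo] with t ht
  have h0 := ht.1.le
  have h1 : 0 ≤ 1 - t := (sub_pos.2 ht.2).le
  rw [extBetaKernel, Real.norm_of_nonneg (by positivity)]
  refine mul_le_one₀ (mul_le_one₀ ?_ (by positivity) ?_) (by positivity) ?_
  · exact Real.rpow_le_one h0 ht.2.le hx
  · exact Real.rpow_le_one h1 (by linarith) hx
  · exact Real.exp_le_one_iff.2 (div_nonpos_of_nonpos_of_nonneg (by linarith) (by positivity))

/-- Grüss-type inequality for extended beta functions: the sharper square-root bound. -/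
theorem extBeta_gruss_sqrt (σ₁ σ₂ x y : ℝ) (hσ₁ : 0 < σ₁) (hσ₂ : 0 < σ₂)
    (hx : 0 < x) (hy : 0 < y) :
    |extBeta (σ₁ + σ₂) (x + y + 1) (x + y + 1) -
        extBeta σ₁ (x + 1) (x + 1) * extBeta σ₂ (y + 1) (y + 1)| ≤
      Real.sqrt (extBeta (2 * σ₁) (2 * x + 1) (2 * x + 1) - extBeta σ₁ (x + 1) (x + 1) ^ 2) *
        Real.sqrt (extBeta (2 * σ₂) (2 * y + 1) (2 * y + 1) - extBeta σ₂ (y + 1) (y + 1) ^ 2) := by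
  have : MeasureTheory.IsProbabilityMeasure
      (MeasureTheory.volume.restrict (Set.Ioo (0 : ℝ) 1)) := ⟨by simp⟩
  have hf := memLp_extBetaKernel hσ₁.le hx.le 2
  have hg := memLp_extBetaKernel hσ₂.le hy.le 2
  have h := abs_covariance_le_sqrt_variance_mul_sqrt_variance hf hg
  rw [ProbabilityTheory.covariance_eq_sub hf hg, ProbabilityTheory.variance_eq_sub hf,
    ProbabilityTheory.variance_eq_sub hg] at h
  simp only [Pi.mul_apply, Pi.pow_apply, pow_two (extBetaKernel _ _ _),
    ← extBeta_add_add_add_one, ← extBeta_add_one] at h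
  simpa only [two_mul] using h
end

section
/- Let σ ≥ 0 and c > b > 0. Then the function x ↦ Φ_σ(b; c; x) is log-convex on ℝ; that is, for all x, y ∈ ℝ and α ∈ [0, 1], Φ_σ(b; c; α x + (1−α) y) ≤ (Φ_σ(b; c; x))^α · (Φ_σ(b; c; y))^{1−α}. -/
open Real intervalIntegral

/-- The classical Euler beta function. -/
noncomputable def classicalBeta (u v : ℝ) : ℝ :=
  Real.Gamma u * Real.Gamma v / Real.Gamma (u + v)

/-- The extended confluent hypergeometric function. -/
noncomputable def extCHF (σ b c x : ℝ) : ℝ :=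
  (1 / classicalBeta b (c - b)) *
    ∫ t in (0:ℝ)..1, t ^ (b - 1) * (1 - t) ^ (c - b - 1) *
      Real.exp (x * t - σ / (t * (1 - t)))

open MeasureTheory in
/-- **Hölder's inequality** for nonnegative integrable functions, in weighted form. -/
theorem integral_rpow_mul_rpow_le_of_nonneg {X : Type*} [MeasurableSpace X] {μ : Measure X}
    {f g : X → ℝ} (hf : Integrable f μ) (hg : Integrable g μ) (hf0 : 0 ≤ᵐ[μ] f)
    (hg0 : 0 ≤ᵐ[μ] g) {p q : ℝ} (hp : 0 ≤ p) (hq : 0 ≤ q) (hpq : p + q = 1) :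
    ∫ a, f a ^ p * g a ^ q ∂μ ≤ (∫ a, f a ∂μ) ^ p * (∫ a, g a ∂μ) ^ q := by
  have hfm := hf.aestronglyMeasurable.aemeasurable
  have hgm := hg.aestronglyMeasurable.aemeasurable
  rw [integral_eq_lintegral_of_nonneg_ae hf0 hf.1, integral_eq_lintegral_of_nonneg_ae hg0 hg.1,
    integral_eq_lintegral_of_nonneg_ae
      (by filter_upwards [hf0, hg0] with a ha hb
          exact mul_nonneg (Real.rpow_nonneg ha p) (Real.rpow_nonneg hb q))
      (AEMeasurable.aestronglyMeasurable (by fun_prop)),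
    ENNReal.toReal_rpow, ENNReal.toReal_rpow, ← ENNReal.toReal_mul]
  have hle := ENNReal.lintegral_mul_norm_pow_le hfm.ennreal_ofReal hgm.ennreal_ofReal hp hq hpq
  refine ENNReal.toReal_mono (ENNReal.mul_ne_top
    (ENNReal.rpow_ne_top_of_nonneg hp hf.lintegral_lt_top.ne)
    (ENNReal.rpow_ne_top_of_nonneg hq hg.lintegral_lt_top.ne)) (le_of_eq_of_le ?_ hle)
  refine lintegral_congr_ae ?_
  filter_upwards [hf0, hg0] with a ha hb
  rw [ENNReal.ofReal_mul (Real.rpow_nonneg ha p), ENNReal.ofReal_rpow_of_nonneg ha hp,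
    ENNReal.ofReal_rpow_of_nonneg hb hq]

theorem classicalBeta_pos {u v : ℝ} (hu : 0 < u) (hv : 0 < v) : 0 < classicalBeta u v :=
  ProbabilityTheory.beta_pos hu hv

open MeasureTheory in
theorem integrableOn_rpow_mul_one_sub_rpow_s12 {u v : ℝ} (hu : 0 < u) (hv : 0 < v) :
    IntegrableOn (fun t : ℝ => t ^ (u - 1) * (1 - t) ^ (v - 1)) (Set.Ioo 0 1) := by
  have h := (Complex.betaIntegral_convergent (u := u) (v := v) (by simpa) (by simpa)).norm
  rw [intervalIntegrable_iff_integrableOn_Ioo_of_le zero_le_one] at h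
  refine h.congr_fun (fun t ht => ?_) measurableSet_Ioo
  have h1 : 0 < 1 - t := sub_pos.2 ht.2
  have h2 : (1 : ℂ) - t = ((1 - t : ℝ) : ℂ) := by push_cast; rfl
  simp [h2, Complex.norm_cpow_eq_rpow_re_of_pos ht.1, Complex.norm_cpow_eq_rpow_re_of_pos h1,
    -Complex.ofReal_sub]

open MeasureTheory in
theorem integrableOn_extCHF_integrand {σ b c : ℝ} (hσ : 0 ≤ σ) (hb : 0 < b) (hbc : b < c)
    (x : ℝ) :
    IntegrableOn (fun t : ℝ => t ^ (b - 1) * (1 - t) ^ (c - b - 1) *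
      Real.exp (x * t - σ / (t * (1 - t)))) (Set.Ioo 0 1) := by
  refine (integrableOn_rpow_mul_one_sub_rpow_s12 hb (sub_pos.2 hbc)).mul_bdd (c := Real.exp |x|)
    (Measurable.aestronglyMeasurable (by fun_prop)) ?_
  refine ae_restrict_of_forall_mem measurableSet_Ioo fun t ht => ?_
  have h1 : 0 ≤ σ / (t * (1 - t)) :=
    div_nonneg hσ (mul_nonneg ht.1.le (sub_nonneg.2 ht.2.le))
  have h2 : x * t ≤ |x| :=
    (mul_le_mul_of_nonneg_right (le_abs_self x) ht.1.le).trans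
      (mul_le_of_le_one_right (abs_nonneg x) ht.2.le)
  rw [Real.norm_eq_abs, Real.abs_exp]
  exact Real.exp_le_exp.2 (by linarith)

/-- x ↦ Φ_σ(b; c; x) is log-convex on ℝ. -/
theorem extCHF_logConvex_in_x (σ b c : ℝ) (hσ : 0 ≤ σ) (hb : 0 < b) (hbc : b < c) :
    ∀ x y α : ℝ, α ∈ Set.Icc (0:ℝ) 1 →
      extCHF σ b c (α * x + (1 - α) * y) ≤
        extCHF σ b c x ^ α * extCHF σ b c y ^ (1 - α) := by
  intro x y α hα
  have hα' : 0 ≤ 1 - α := sub_nonneg.2 hα.2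
  have hB : 0 < 1 / classicalBeta b (c - b) :=
    one_div_pos.2 (classicalBeta_pos hb (sub_pos.2 hbc))
  have hnonneg (z t : ℝ) (ht : t ∈ Set.Ioo (0:ℝ) 1) : 0 ≤ t ^ (b - 1) * (1 - t) ^ (c - b - 1) *
      Real.exp (z * t - σ / (t * (1 - t))) :=
    mul_nonneg (mul_nonneg (Real.rpow_nonneg ht.1.le _)
      (Real.rpow_nonneg (sub_nonneg.2 ht.2.le) _)) (Real.exp_nonneg _)
  have holder := integral_rpow_mul_rpow_le_of_nonneg
    (integrableOn_extCHF_integrand hσ hb hbc x) (integrableOn_extCHF_integrand hσ hb hbc y)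
    (MeasureTheory.ae_restrict_of_forall_mem measurableSet_Ioo (hnonneg x))
    (MeasureTheory.ae_restrict_of_forall_mem measurableSet_Ioo (hnonneg y))
    hα.1 hα' (add_sub_cancel α 1)
  simp only [extCHF, integral_of_le zero_le_one, MeasureTheory.integral_Ioc_eq_integral_Ioo]
  rw [Real.mul_rpow hB.le (MeasureTheory.setIntegral_nonneg measurableSet_Ioo (hnonneg x)),
    Real.mul_rpow hB.le (MeasureTheory.setIntegral_nonneg measurableSet_Ioo (hnonneg y)),
    mul_mul_mul_comm, ← Real.rpow_add hB, add_sub_cancel, Real.rpow_one]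
  refine mul_le_mul_of_nonneg_left (le_of_eq_of_le ?_ holder) hB.le
  refine MeasureTheory.setIntegral_congr_fun measurableSet_Ioo fun t ht => ?_
  have hw : 0 < t ^ (b - 1) * (1 - t) ^ (c - b - 1) :=
    mul_pos (Real.rpow_pos_of_pos ht.1 _) (Real.rpow_pos_of_pos (sub_pos.2 ht.2) _)
  rw [Real.mul_rpow hw.le (Real.exp_nonneg _), Real.mul_rpow hw.le (Real.exp_nonneg _),
    mul_mul_mul_comm, ← Real.rpow_add hw, add_sub_cancel, Real.rpow_one, ← Real.exp_mul,
    ← Real.exp_mul, ← Real.exp_add]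
  congr 2
  ring
end

section
/- Let b > 0 and c > 0. Define f(δ) = (Γ(b+δ))² Γ(b+2δ+c) Γ(b+c) / ((Γ(b+c+δ))² Γ(b+2δ) Γ(b)) for δ ≥ 0, where Γ denotes the Gamma function. Then f is decreasing on [0, ∞); in particular f(δ) ≤ f(0) = 1 for all δ ≥ 0, i.e. B(b+δ, c)² ≤ B(b+2δ, c) · B(b, c), where B(u, v) = Γ(u)Γ(v)/Γ(u+v) is the classical Euler beta function. -/
open Real

/-- The logarithm of a single factor of the Euler product for the Gamma quotient is decreasing. -/
lemma antitoneOn_log_shift {x c : ℝ} (hx : 0 < x) (hc : 0 < c) :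
    AntitoneOn (fun δ : ℝ => 2 * (log (x + c + δ) - log (x + δ)) -
      (log (x + c + 2 * δ) - log (x + 2 * δ))) (Set.Ici 0) := by
  have hderiv : ∀ δ : ℝ, 0 ≤ δ → HasDerivAt (fun δ : ℝ =>
      2 * (log (x + c + δ) - log (x + δ)) - (log (x + c + 2 * δ) - log (x + 2 * δ)))
      (2 * (1 / (x + c + δ) - 1 / (x + δ)) -
        (2 * 1 / (x + c + 2 * δ) - 2 * 1 / (x + 2 * δ))) δ := by
    intro δ hδ
    have h1 (a : ℝ) (ha : 0 < a) : HasDerivAt (fun δ : ℝ => log (a + δ)) (1 / (a + δ)) δ :=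
      ((hasDerivAt_id δ).const_add a).log (by simp only [id]; positivity)
    have h2 (a : ℝ) (ha : 0 < a) :
        HasDerivAt (fun δ : ℝ => log (a + 2 * δ)) (2 * 1 / (a + 2 * δ)) δ :=
      (((hasDerivAt_id δ).const_mul 2).const_add a).log (by simp only [id]; positivity)
    have hxc : 0 < x + c := by positivity
    exact (((h1 _ hxc).sub (h1 _ hx)).const_mul 2).sub ((h2 _ hxc).sub (h2 _ hx))
  refine antitoneOn_of_deriv_nonpos (convex_Ici 0)
    (fun δ hδ => (hderiv δ hδ).continuousAt.continuousWithinAt)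
    (fun δ hδ => (hderiv δ (interior_subset hδ)).differentiableAt.differentiableWithinAt) ?_
  intro δ hδ
  have hδ : 0 ≤ δ := interior_subset hδ
  rw [(hderiv δ hδ).deriv]
  have hle : c / ((x + 2 * δ) * (x + c + 2 * δ)) ≤ c / ((x + δ) * (x + c + δ)) := by
    gcongr <;> linarith
  have heq : 2 * (1 / (x + c + δ) - 1 / (x + δ)) -
      (2 * 1 / (x + c + 2 * δ) - 2 * 1 / (x + 2 * δ)) =
      2 * (c / ((x + 2 * δ) * (x + c + 2 * δ)) - c / ((x + δ) * (x + c + δ))) := by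
    have : x + δ ≠ 0 := by positivity
    have : x + c + δ ≠ 0 := by positivity
    have : x + 2 * δ ≠ 0 := by positivity
    have : x + c + 2 * δ ≠ 0 := by positivity
    field_simp
    ring
  rw [heq]
  linarith

/-- The nonconstant part of the logarithm of the Gamma quotient is decreasing. -/
lemma antitoneOn_log_Gamma_shift {b c : ℝ} (hb : 0 < b) (hc : 0 < c) :
    AntitoneOn (fun δ : ℝ => 2 * (log (Gamma (b + δ)) - log (Gamma (b + c + δ))) -
      (log (Gamma (b + 2 * δ)) - log (Gamma (b + c + 2 * δ)))) (Set.Ici 0) := by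
  have hlim (δ : ℝ) (hδ : 0 ≤ δ) :
      Filter.Tendsto (fun n : ℕ => -c * log n + ∑ m ∈ Finset.range (n + 1),
        (2 * (log (b + m + c + δ) - log (b + m + δ)) -
          (log (b + m + c + 2 * δ) - log (b + m + 2 * δ)))) Filter.atTop
        (nhds (2 * (log (Gamma (b + δ)) - log (Gamma (b + c + δ))) -
          (log (Gamma (b + 2 * δ)) - log (Gamma (b + c + 2 * δ))))) := by
    have h (a : ℝ) (ha : 0 < a) := BohrMollerup.tendsto_log_gamma ha
    refine (((((h (b + δ) (by positivity)).sub (h (b + c + δ) (by positivity))).const_mul 2).sub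
      ((h (b + 2 * δ) (by positivity)).sub (h (b + c + 2 * δ) (by positivity))))).congr ?_
    intro n
    simp only [BohrMollerup.logGammaSeq, Finset.sum_sub_distrib, ← Finset.mul_sum,
      add_right_comm _ _ (Nat.cast _ : ℝ)]
    ring
  intro δ hδ ε hε hle
  refine le_of_tendsto_of_tendsto' (hlim ε hε) (hlim δ hδ) fun n => ?_
  gcongr -c * log n + ?_
  exact Finset.sum_le_sum fun m _ =>
    antitoneOn_log_shift (x := b + m) (by positivity) hc hδ hε hle

/-- The Gamma-quotient f(δ) is decreasing on [0, ∞), f(0) = 1, and consequently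
B(b+δ, c)² ≤ B(b+2δ, c)·B(b, c). -/
theorem gamma_quotient_decreasing (b c : ℝ) (hb : 0 < b) (hc : 0 < c) :
    AntitoneOn (fun δ : ℝ =>
        Real.Gamma (b + δ) ^ 2 * Real.Gamma (b + 2 * δ + c) * Real.Gamma (b + c) /
          (Real.Gamma (b + c + δ) ^ 2 * Real.Gamma (b + 2 * δ) * Real.Gamma b))
      (Set.Ici 0) ∧
    Real.Gamma (b + 0) ^ 2 * Real.Gamma (b + 2 * 0 + c) * Real.Gamma (b + c) /
        (Real.Gamma (b + c + 0) ^ 2 * Real.Gamma (b + 2 * 0) * Real.Gamma b) = 1 ∧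
    ∀ δ : ℝ, 0 ≤ δ →
      (Real.Gamma (b + δ) ^ 2 * Real.Gamma (b + 2 * δ + c) * Real.Gamma (b + c) /
          (Real.Gamma (b + c + δ) ^ 2 * Real.Gamma (b + 2 * δ) * Real.Gamma b) ≤ 1 ∧
        classicalBeta (b + δ) c ^ 2 ≤ classicalBeta (b + 2 * δ) c * classicalBeta b c) := by
  set f : ℝ → ℝ := fun δ => Gamma (b + δ) ^ 2 * Gamma (b + 2 * δ + c) * Gamma (b + c) /
    (Gamma (b + c + δ) ^ 2 * Gamma (b + 2 * δ) * Gamma b) with hf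
  have hΓ (a : ℝ) (ha : 0 < a) : 0 < Gamma a := Gamma_pos_of_pos ha
  have hb0 := hΓ b hb
  have hbc0 := hΓ (b + c) (by positivity)
  have hanti : AntitoneOn f (Set.Ici 0) := by
    have hexp : Set.EqOn (fun δ => exp (2 * (log (Gamma (b + δ)) - log (Gamma (b + c + δ))) -
        (log (Gamma (b + 2 * δ)) - log (Gamma (b + c + 2 * δ)))) * (Gamma (b + c) / Gamma b))
        f (Set.Ici 0) := by
      intro δ hδ
      have hδ : 0 ≤ δ := hδ
      have h1 := hΓ (b + δ) (by positivity)
      have h2 := hΓ (b + c + δ) (by positivity)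
      have h3 := hΓ (b + 2 * δ) (by positivity)
      have h4 := hΓ (b + c + 2 * δ) (by positivity)
      simp only [hf, two_mul (log _ - log _), exp_sub, exp_add, exp_log h1, exp_log h2,
        exp_log h3, exp_log h4, add_right_comm b (2 * δ) c]
      field_simp
    refine AntitoneOn.congr ?_ hexp
    intro δ hδ ε hε hle
    have := antitoneOn_log_Gamma_shift hb hc hδ hε hle
    dsimp only at this ⊢
    gcongr
  have hzero : f 0 = 1 := by
    simp only [hf, mul_zero, add_zero]
    field_simp
  refine ⟨hanti, hzero, fun δ hδ => ?_⟩
  have hle : f δ ≤ 1 := hzero ▸ hanti Set.self_mem_Ici hδ hδ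
  refine ⟨hle, ?_⟩
  have h1 := hΓ (b + δ) (by positivity)
  have h2 := hΓ (b + c + δ) (by positivity)
  have h3 := hΓ (b + 2 * δ) (by positivity)
  have h4 := hΓ (b + 2 * δ + c) (by positivity)
  have h5 := hΓ c hc
  have hprod : classicalBeta (b + δ) c ^ 2 =
      f δ * (classicalBeta (b + 2 * δ) c * classicalBeta b c) := by
    simp only [hf, classicalBeta, add_right_comm b δ c]
    field_simp
  rw [hprod]
  refine mul_le_of_le_one_left ?_ hle
  unfold classicalBeta
  positivity
end
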